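/- Let G(q)=1/((q,q^4;q^5)_∞) and H(q)=1/((q^2,q^3;q^5)_∞). Then H(q)^4 G(q^2)^2 - G(q)^4 H(q^2)^2 + G(q)^2 H(q)^2 G(q^2) H(q^2) = G(q^2)^3 H(q^2)^3/(G(q)^2 H(q)^2). -/

import Mathlib

/-- Euler's product E(q) = ∏_{k≥0} (1 - q^{k+1}). -/
noncomputable def E (q : ℂ) : ℂ := ∏' k : ℕ, (1 - q ^ (k + 1))

/-- q-Pochhammer infinite product (a;q)_∞ = ∏_{k≥0} (1 - a q^k). -/
noncomputable def qp (a q : ℂ) : ℂ := ∏' k : ℕ, (1 - a * q ^ k)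

/-- Rogers–Ramanujan function G(q) = 1/((q,q^4;q^5)_∞). -/
noncomputable def G (q : ℂ) : ℂ := 1 / (qp q (q ^ 5) * qp (q ^ 4) (q ^ 5))

/-- Rogers–Ramanujan function H(q) = 1/((q^2,q^3;q^5)_∞). -/
noncomputable def H (q : ℂ) : ℂ := 1 / (qp (q ^ 2) (q ^ 5) * qp (q ^ 3) (q ^ 5))

/-- Rogers–Ramanujan continued fraction product R(q). -/
noncomputable def R (q : ℂ) : ℂ :=
  (qp q (q ^ 5) * qp (q ^ 4) (q ^ 5)) / (qp (q ^ 2) (q ^ 5) * qp (q ^ 3) (q ^ 5))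

open Filter Topology Finset

lemma multipliable_qp (a : ℂ) {p : ℂ} (hp : ‖p‖ < 1) :
    Multipliable fun k : ℕ => 1 - a * p ^ k := by
  have h : Summable fun k : ℕ => ‖-(a * p ^ k)‖ := by
    simpa [norm_mul, norm_pow] using
      (summable_geometric_of_lt_one (norm_nonneg p) hp).mul_left ‖a‖
  simpa [sub_eq_add_neg] using multipliable_one_add_of_summable h

lemma tendsto_qp (a : ℂ) {p : ℂ} (hp : ‖p‖ < 1) :
    Tendsto (fun n => ∏ k ∈ range n, (1 - a * p ^ k)) atTop (𝓝 (qp a p)) :=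
  (multipliable_qp a hp).tendsto_prod_tprod_nat

lemma qp_ne_zero {a p : ℂ} (hp : ‖p‖ < 1) (ha : ‖a‖ < 1) : qp a p ≠ 0 := by
  have h : Summable fun k : ℕ => ‖-(a * p ^ k)‖ := by
    simpa [norm_mul, norm_pow] using
      (summable_geometric_of_lt_one (norm_nonneg p) hp).mul_left ‖a‖
  have h0 : ∀ k : ℕ, 1 + -(a * p ^ k) ≠ 0 := by
    intro k hk
    have h1 : a * p ^ k = 1 := by linear_combination -hk
    have h2 : ‖a * p ^ k‖ < 1 := by
      rw [norm_mul, norm_pow]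
      exact (mul_le_of_le_one_right (norm_nonneg a)
        (pow_le_one₀ (norm_nonneg p) hp.le)).trans_lt ha
    rw [h1, norm_one] at h2
    exact lt_irrefl _ h2
  simpa [qp, sub_eq_add_neg] using tprod_one_add_ne_zero_of_summable h0 h

/-- Splitting the product `(a; p)_∞` according to residue classes modulo `d`. -/
lemma qp_eq_prod_residues (a : ℂ) {p : ℂ} (hp : ‖p‖ < 1) {d : ℕ} (hd : d ≠ 0) :
    qp a p = ∏ i ∈ range d, qp (a * p ^ i) (p ^ d) := by
  have hpd : ‖p ^ d‖ < 1 := by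
    rw [norm_pow]; exact pow_lt_one₀ (norm_nonneg p) hp hd
  have h1 : Tendsto (fun n => ∏ k ∈ range (d * n), (1 - a * p ^ k)) atTop (𝓝 (qp a p)) :=
    (tendsto_qp a hp).comp (tendsto_id.const_mul_atTop' (Nat.pos_of_ne_zero hd))
  have h2 := tendsto_finsetProd (range d) fun i _ => tendsto_qp (a * p ^ i) hpd
  refine tendsto_nhds_unique h1 (h2.congr fun n => ?_)
  induction n with
  | zero => simp
  | succ n ih =>
    simp_rw [prod_range_succ _ n, prod_mul_distrib, ih, mul_add, mul_one, prod_range_add]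
    congr 1
    refine prod_congr rfl fun i _ => ?_
    ring

lemma qp_mul_qp_neg (a : ℂ) {p : ℂ} (hp : ‖p‖ < 1) :
    qp a p * qp (-a) p = qp (a ^ 2) (p ^ 2) := by
  rw [qp, qp, qp, ← (multipliable_qp a hp).tprod_mul (multipliable_qp (-a) hp)]
  refine tprod_congr fun k => ?_
  ring

/-- Gaussian binomial coefficients, defined by a `q`-Pascal rule. -/
def gaussBinom (p : ℂ) : ℕ → ℕ → ℂ
  | _, 0 => 1
  | 0, _ + 1 => 0
  | n + 1, k + 1 => p ^ (k + 1) * gaussBinom p n (k + 1) + gaussBinom p n k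

lemma gaussBinom_zero_right (p : ℂ) (n : ℕ) : gaussBinom p n 0 = 1 := by
  cases n <;> rfl

lemma gaussBinom_eq_zero (p : ℂ) {n k : ℕ} (h : n < k) : gaussBinom p n k = 0 := by
  induction n generalizing k with
  | zero => obtain ⟨k, rfl⟩ := Nat.exists_eq_succ_of_ne_zero h.ne'; rfl
  | succ n ih =>
    obtain ⟨k, rfl⟩ := Nat.exists_eq_succ_of_ne_zero (Nat.ne_zero_of_lt h)
    rw [gaussBinom, ih (by omega), ih (by omega)]
    ring

lemma gaussBinom_self (p : ℂ) (n : ℕ) : gaussBinom p n n = 1 := by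
  induction n with
  | zero => rfl
  | succ n ih => rw [gaussBinom, gaussBinom_eq_zero p (Nat.lt_succ_self n), ih]; ring

/-- The finite product `(p; p)_n`. -/
def finPoch (p : ℂ) (n : ℕ) : ℂ := ∏ k ∈ range n, (1 - p * p ^ k)

lemma finPoch_succ (p : ℂ) (n : ℕ) : finPoch p (n + 1) = finPoch p n * (1 - p * p ^ n) :=
  prod_range_succ _ _

lemma gaussBinom_mul_finPoch (p : ℂ) (i j : ℕ) :
    gaussBinom p (i + j) i * (finPoch p i * finPoch p j) = finPoch p (i + j) := by
  induction hn : i + j generalizing i j with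
  | zero =>
    obtain ⟨rfl, rfl⟩ : i = 0 ∧ j = 0 := by omega
    simp [gaussBinom, finPoch]
  | succ n ih =>
    rcases i with _ | i
    · obtain rfl : j = n + 1 := by omega
      simp [gaussBinom, finPoch]
    rcases j with _ | j
    · obtain rfl : i = n := by omega
      rw [gaussBinom_self]
      simp [finPoch]
    have h1 := ih (i + 1) j (by omega)
    have h2 := ih i (j + 1) (by omega)
    obtain rfl : n = i + j + 1 := by omega
    rw [gaussBinom, finPoch_succ p (i + j + 1), finPoch_succ p i, finPoch_succ p j]
    rw [finPoch_succ p i] at h1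
    rw [finPoch_succ p j] at h2
    linear_combination p ^ (i + 1) * (1 - p * p ^ j) * h1 + (1 - p * p ^ i) * h2

/-- The finite `q`-binomial theorem in base `w ^ 2`. -/
lemma prod_one_add_mul_pow (w x : ℂ) (M : ℕ) :
    ∏ k ∈ range M, (1 + x * w ^ (2 * k + 1)) =
      ∑ j ∈ range (M + 1), gaussBinom (w ^ 2) M j * w ^ (j * j) * x ^ j := by
  induction M generalizing x with
  | zero => simp [gaussBinom]
  | succ M ih =>
    have h : ∏ k ∈ range M, (1 + x * w ^ (2 * (k + 1) + 1)) =
        ∏ k ∈ range M, (1 + x * w ^ 2 * w ^ (2 * k + 1)) :=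
      prod_congr rfl fun k _ => by ring
    have h3 : ∑ j ∈ range (M + 1), gaussBinom (w ^ 2) M j * w ^ (j * j) * (x * w ^ 2) ^ j =
        ∑ j ∈ range (M + 1),
          gaussBinom (w ^ 2) M (j + 1) * w ^ ((j + 1) * (j + 1)) * (x * w ^ 2) ^ (j + 1) + 1 := by
      rw [sum_range_succ', sum_range_succ _ M, gaussBinom_eq_zero _ (Nat.lt_succ_self M),
        gaussBinom_zero_right]
      simp
    rw [prod_range_succ', h, ih, mul_add, mul_one]
    nth_rewrite 1 [h3]
    rw [sum_mul, add_right_comm, ← sum_add_distrib, sum_range_succ' _ (M + 1)]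
    congr 1
    · refine sum_congr rfl fun j _ => ?_
      rw [gaussBinom]
      ring
    · simp [gaussBinom]

lemma prod_one_add_mul_zpow {w z : ℂ} (hw : w ≠ 0) (hz : z ≠ 0) (N : ℕ) :
    ∏ k ∈ range N, (1 + z * w ^ (2 * (k : ℤ) + 1 - 2 * N)) =
      z ^ N * w ^ (-(N : ℤ) ^ 2) * ∏ k ∈ range N, (1 + z⁻¹ * w ^ (2 * k + 1)) := by
  induction N with
  | zero => simp
  | succ N ih =>
    have h : ∏ k ∈ range N, (1 + z * w ^ (2 * ((k + 1 : ℕ) : ℤ) + 1 - 2 * ((N + 1 : ℕ) : ℤ))) =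
        ∏ k ∈ range N, (1 + z * w ^ (2 * (k : ℤ) + 1 - 2 * N)) := by
      refine prod_congr rfl fun k _ => ?_
      congr 3
      push_cast
      ring
    rw [prod_range_succ', h, ih, prod_range_succ]
    have e1 : w ^ (-((N + 1 : ℕ) : ℤ) ^ 2) = w ^ (-(N : ℤ) ^ 2) * (w ^ (2 * N + 1))⁻¹ := by
      rw [← zpow_natCast, ← zpow_neg, ← zpow_add₀ hw]
      congr 1
      push_cast
      ring
    have e2 : w ^ (2 * ((0 : ℕ) : ℤ) + 1 - 2 * ((N + 1 : ℕ) : ℤ)) = (w ^ (2 * N + 1))⁻¹ := by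
      rw [← zpow_natCast, ← zpow_neg]
      congr 1
    rw [e1, e2]
    have : w ^ (2 * N + 1) ≠ 0 := pow_ne_zero _ hw
    field_simp
    ring

/-- The finite form of the Jacobi triple product identity. -/
lemma finite_jacobi_triple_product {w z : ℂ} (hw : w ≠ 0) (hz : z ≠ 0) (N : ℕ) :
    (∏ k ∈ range N, (1 + z * w ^ (2 * k + 1))) * ∏ k ∈ range N, (1 + z⁻¹ * w ^ (2 * k + 1)) =
      ∑ n ∈ Icc (-(N : ℤ)) N,
        gaussBinom (w ^ 2) (2 * N) (n + N).toNat * (z ^ n * w ^ (n ^ 2)) := by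
  have h1 := prod_one_add_mul_pow w (z * w ^ (-(2 * N : ℤ))) (2 * N)
  have h2 : ∀ k : ℕ, 1 + z * w ^ (-(2 * N : ℤ)) * w ^ (2 * k + 1) =
      1 + z * w ^ (2 * (k : ℤ) + 1 - 2 * N) := fun k => by
    rw [mul_assoc, ← zpow_natCast w (2 * k + 1), ← zpow_add₀ hw]
    congr 3
    push_cast
    ring
  have h3 : ∏ k ∈ range N, (1 + z * w ^ (2 * ((N + k : ℕ) : ℤ) + 1 - 2 * N)) =
      ∏ k ∈ range N, (1 + z * w ^ (2 * k + 1)) := by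
    refine prod_congr rfl fun k _ => ?_
    rw [← zpow_natCast w (2 * k + 1)]
    congr 3
    push_cast
    ring
  simp_rw [h2] at h1
  rw [two_mul N, prod_range_add, h3, prod_one_add_mul_zpow hw hz, ← two_mul] at h1
  have h4 : z ^ N * w ^ (-(N : ℤ) ^ 2) ≠ 0 :=
    mul_ne_zero (pow_ne_zero _ hz) (zpow_ne_zero _ hw)
  apply mul_left_cancel₀ h4
  have h5 : ∑ n ∈ Icc (-(N : ℤ)) N,
        gaussBinom (w ^ 2) (2 * N) (n + N).toNat * (z ^ n * w ^ (n ^ 2)) =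
      ∑ j ∈ range (2 * N + 1),
        gaussBinom (w ^ 2) (2 * N) j * (z ^ ((j : ℤ) - N) * w ^ (((j : ℤ) - N) ^ 2)) := by
    symm
    refine sum_bij (fun j _ => (j : ℤ) - N) ?_ ?_ ?_ ?_
    · intro j hj
      simp only [mem_range, mem_Icc] at *
      omega
    · intro i _ j _ h
      simpa using h
    · intro n hn
      simp only [mem_Icc] at hn
      exact ⟨(n + N).toNat, by simp only [mem_range]; omega, by omega⟩
    · intro j _
      simp
  rw [h5, mul_sum, mul_comm (∏ k ∈ range N, (1 + z * w ^ (2 * k + 1))), ← mul_assoc, h1]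
  refine sum_congr rfl fun j _ => ?_
  have e1 : z ^ ((j : ℤ) - N) = z ^ j * (z ^ N)⁻¹ := by
    rw [zpow_sub₀ hz, zpow_natCast, zpow_natCast, div_eq_mul_inv]
  have e2 : w ^ (j * j) * (w ^ (-(2 * N : ℤ))) ^ j =
      w ^ (-(N : ℤ) ^ 2) * w ^ (((j : ℤ) - N) ^ 2) := by
    rw [← zpow_natCast, ← zpow_natCast, ← zpow_mul, ← zpow_add₀ hw, ← zpow_add₀ hw]
    congr 1
    push_cast
    ring
  have : z ^ N ≠ 0 := pow_ne_zero _ hz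
  rw [e1, mul_pow]
  field_simp
  linear_combination gaussBinom (w ^ 2) (2 * N) j * e2

lemma summable_zpow_mul_zpow_sq {w z : ℂ} (hw : w ≠ 0) (hw1 : ‖w‖ < 1) (hz : z ≠ 0) :
    Summable fun n : ℤ => z ^ n * w ^ (n ^ 2) := by
  have hpi : (Real.pi : ℂ) ≠ 0 := by exact_mod_cast Real.pi_ne_zero
  have e : Complex.log w / (Real.pi * Complex.I) =
      ((Real.pi⁻¹ : ℝ) : ℂ) * (-(Complex.I * Complex.log w)) := by
    push_cast
    field_simp
    linear_combination Complex.log w * Complex.I_sq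
  have him : 0 < (Complex.log w / (Real.pi * Complex.I)).im := by
    rw [e, Complex.im_ofReal_mul, Complex.neg_im, Complex.I_mul_im, Complex.log_re]
    have := Real.log_neg (norm_pos_iff.2 hw) hw1
    have := Real.pi_pos
    exact mul_pos (by positivity) (by linarith)
  refine ((summable_jacobiTheta₂_term_iff
    (Complex.log z / (2 * Real.pi * Complex.I)) _).2 him).congr fun n => ?_
  have hI := Complex.I_ne_zero
  have e1 : 2 * Real.pi * Complex.I * n * (Complex.log z / (2 * Real.pi * Complex.I)) +
      Real.pi * Complex.I * (n : ℂ) ^ 2 * (Complex.log w / (Real.pi * Complex.I)) =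
      (n : ℤ) * Complex.log z + ((n ^ 2 : ℤ) : ℂ) * Complex.log w := by
    push_cast
    field_simp
  rw [jacobiTheta₂_term, e1, Complex.exp_add, Complex.exp_int_mul, Complex.exp_int_mul,
    Complex.exp_log hz, Complex.exp_log hw]

/-- The Jacobi triple product identity. -/
theorem jacobi_triple_product {w z : ℂ} (hw : w ≠ 0) (hw1 : ‖w‖ < 1) (hz : z ≠ 0) :
    ∑' n : ℤ, z ^ n * w ^ (n ^ 2) =
      qp (w ^ 2) (w ^ 2) * qp (-(z * w)) (w ^ 2) * qp (-(z⁻¹ * w)) (w ^ 2) := by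
  have hp : ‖w ^ 2‖ < 1 := by
    rw [norm_pow]; exact pow_lt_one₀ (norm_nonneg w) hw1 two_ne_zero
  have hE : qp (w ^ 2) (w ^ 2) ≠ 0 := qp_ne_zero hp hp
  have hfin : Tendsto (finPoch (w ^ 2)) atTop (𝓝 (qp (w ^ 2) (w ^ 2))) := tendsto_qp _ hp
  have hne : ∀ n, finPoch (w ^ 2) n ≠ 0 := fun n => by
    refine prod_ne_zero_iff.2 fun k _ h => ?_
    have h1 : (w ^ 2) ^ (k + 1) = 1 := by linear_combination -h
    have h2 : ‖(w ^ 2) ^ (k + 1)‖ < 1 := by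
      rw [norm_pow]; exact pow_lt_one₀ (norm_nonneg _) hp (Nat.succ_ne_zero k)
    rw [h1, norm_one] at h2
    exact lt_irrefl _ h2
  have hbinom : ∀ i j, gaussBinom (w ^ 2) (i + j) i =
      finPoch (w ^ 2) (i + j) * (finPoch (w ^ 2) i)⁻¹ * (finPoch (w ^ 2) j)⁻¹ := fun i j => by
    rw [← gaussBinom_mul_finPoch]
    have := hne i
    have := hne j
    field_simp
  obtain ⟨B, hB⟩ := hfin.norm.bddAbove_range
  obtain ⟨C, hC⟩ := (hfin.inv₀ hE).norm.bddAbove_range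
  have hB' : ∀ n, ‖finPoch (w ^ 2) n‖ ≤ B := fun n => hB ⟨n, rfl⟩
  have hC' : ∀ n, ‖(finPoch (w ^ 2) n)⁻¹‖ ≤ C := fun n => hC ⟨n, rfl⟩
  have hB0 : 0 ≤ B := (norm_nonneg _).trans (hB' 0)
  have hC0 : 0 ≤ C := (norm_nonneg _).trans (hC' 0)
  have hsplit : ∀ {N : ℕ} {n : ℤ}, n ∈ Icc (-(N : ℤ)) N →
      2 * N = (n + N).toNat + (N - n).toNat := fun {N n} hn => by
    rw [mem_Icc] at hn
    omega
  have hlim : Tendsto (fun N : ℕ => ∑' n : ℤ, if n ∈ Icc (-(N : ℤ)) N then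
        gaussBinom (w ^ 2) (2 * N) (n + N).toNat * (z ^ n * w ^ (n ^ 2)) else 0) atTop
      (𝓝 (∑' n : ℤ, (qp (w ^ 2) (w ^ 2))⁻¹ * (z ^ n * w ^ (n ^ 2)))) := by
    refine tendsto_tsum_of_dominated_convergence
      (bound := fun n : ℤ => B * C * C * ‖z ^ n * w ^ (n ^ 2)‖)
      ((summable_zpow_mul_zpow_sq hw hw1 hz).norm.mul_left _) (fun n => ?_)
      (Eventually.of_forall fun N n => ?_)
    · have t1 : Tendsto (fun N : ℕ => (n + N).toNat) atTop atTop :=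
        tendsto_atTop.2 fun b => by
          filter_upwards [eventually_ge_atTop (b + n.natAbs)] with N hN
          omega
      have t2 : Tendsto (fun N : ℕ => ((N : ℤ) - n).toNat) atTop atTop :=
        tendsto_atTop.2 fun b => by
          filter_upwards [eventually_ge_atTop (b + n.natAbs)] with N hN
          omega
      have t3 : Tendsto (fun N : ℕ => 2 * N) atTop atTop :=
        tendsto_atTop.2 fun b => by
          filter_upwards [eventually_ge_atTop b] with N hN
          omega
      have t := (((hfin.comp t3).mul ((hfin.comp t1).inv₀ hE)).mul
        ((hfin.comp t2).inv₀ hE)).mul_const (z ^ n * w ^ (n ^ 2))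
      rw [mul_inv_cancel₀ hE, one_mul] at t
      refine t.congr' ?_
      filter_upwards [eventually_ge_atTop n.natAbs] with N hN
      have hn : n ∈ Icc (-(N : ℤ)) N := by rw [mem_Icc]; omega
      rw [if_pos hn]
      have := hbinom (n + N).toNat (N - n).toNat
      rw [← hsplit hn] at this
      rw [this]
      rfl
    · split_ifs with hn
      · have := hbinom (n + N).toNat (N - n).toNat
        rw [← hsplit hn] at this
        rw [norm_mul, this, norm_mul, norm_mul]
        gcongr
        · exact hB' _
        · exact hC' _
        · exact hC' _
      · rw [norm_zero]
        positivity
  have hprod : Tendsto (fun N : ℕ => ∑' n : ℤ, if n ∈ Icc (-(N : ℤ)) N then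
        gaussBinom (w ^ 2) (2 * N) (n + N).toNat * (z ^ n * w ^ (n ^ 2)) else 0) atTop
      (𝓝 (qp (-(z * w)) (w ^ 2) * qp (-(z⁻¹ * w)) (w ^ 2))) := by
    refine ((tendsto_qp (-(z * w)) hp).mul (tendsto_qp (-(z⁻¹ * w)) hp)).congr fun N => ?_
    have h : ∀ x : ℂ, ∏ k ∈ range N, (1 - -(x * w) * (w ^ 2) ^ k) =
        ∏ k ∈ range N, (1 + x * w ^ (2 * k + 1)) := fun x =>
      prod_congr rfl fun k _ => by ring
    rw [h, h, finite_jacobi_triple_product hw hz, tsum_eq_sum (s := Icc (-(N : ℤ)) N)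
      fun n hn => if_neg hn]
    exact sum_congr rfl fun n hn => (if_pos hn).symm
  have key := tendsto_nhds_unique hlim hprod
  rw [tsum_mul_left] at key
  rw [mul_assoc, ← key, mul_inv_cancel_left₀ hE]

/-- The two-sided theta series `∑ sⁿ w^{a n² + b n}`. -/
noncomputable def thetaSeries (s w : ℂ) (a b : ℤ) : ℂ := ∑' n : ℤ, s ^ n * w ^ (a * n ^ 2 + b * n)

lemma thetaSeries_term_eq {s w : ℂ} (hw : w ≠ 0) (a : ℕ) (b n : ℤ) :
    s ^ n * w ^ ((a : ℤ) * n ^ 2 + b * n) = (s * w ^ b) ^ n * (w ^ a) ^ (n ^ 2) := by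
  rw [zpow_add₀ hw, mul_zpow, ← zpow_natCast w a, ← zpow_mul, ← zpow_mul]
  ring

lemma summable_thetaSeries {s w : ℂ} (hw : w ≠ 0) (hw1 : ‖w‖ < 1) (hs : s ≠ 0) {a : ℕ}
    (ha : a ≠ 0) (b : ℤ) : Summable fun n : ℤ => s ^ n * w ^ ((a : ℤ) * n ^ 2 + b * n) := by
  refine (summable_zpow_mul_zpow_sq (pow_ne_zero a hw) ?_
    (mul_ne_zero hs (zpow_ne_zero b hw))).congr fun n => (thetaSeries_term_eq hw a b n).symm
  rw [norm_pow]
  exact pow_lt_one₀ (norm_nonneg w) hw1 ha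

lemma thetaSeries_eq_prod {s w : ℂ} (hw : w ≠ 0) (hw1 : ‖w‖ < 1) (hs : s ≠ 0) {a : ℕ}
    (ha : a ≠ 0) (b : ℤ) :
    thetaSeries s w a b = qp (w ^ (2 * a)) (w ^ (2 * a)) *
      qp (-(s * w ^ (a + b))) (w ^ (2 * a)) * qp (-(s⁻¹ * w ^ (a - b))) (w ^ (2 * a)) := by
  have h1 : ‖w ^ a‖ < 1 := by
    rw [norm_pow]; exact pow_lt_one₀ (norm_nonneg w) hw1 ha
  rw [thetaSeries, tsum_congr (thetaSeries_term_eq hw a b),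
    jacobi_triple_product (pow_ne_zero a hw) h1 (mul_ne_zero hs (zpow_ne_zero b hw))]
  have e1 : s * w ^ b * w ^ a = s * w ^ (a + b) := by
    rw [zpow_add₀ hw, zpow_natCast]; ring
  have e2 : (s * w ^ b)⁻¹ * w ^ a = s⁻¹ * w ^ (a - b) := by
    rw [zpow_sub₀ hw, zpow_natCast, mul_inv]; ring
  rw [e1, e2, ← pow_mul, mul_comm a 2]

/-- A sum over `ℤ × ℤ` splits along finitely many maps whose ranges partition `ℤ × ℤ`. -/
lemma tsum_eq_sum_tsum_of_bijective {ι α : Type*} [Fintype ι] {f : α → ℂ} (hf : Summable f)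
    (e : ι × α → α) (he : Function.Bijective e) :
    ∑' x, f x = ∑ i, ∑' y, f (e (i, y)) := by
  rw [← (Equiv.ofBijective e he).tsum_eq f]
  simp only [Equiv.ofBijective_apply]
  rw [Summable.tsum_prod (f := fun x => f (e x)) ((Equiv.ofBijective e he).summable_iff.2 hf),
    tsum_fintype]

lemma thetaSeries_mul {s t w : ℂ} (hw : w ≠ 0) (hw1 : ‖w‖ < 1) (hs : s ≠ 0) (ht : t ≠ 0)
    {a c : ℕ} (ha : a ≠ 0) (hc : c ≠ 0) (b d : ℤ) :
    (Summable fun x : ℤ × ℤ =>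
      s ^ x.1 * t ^ x.2 * w ^ (a * x.1 ^ 2 + b * x.1 + (c * x.2 ^ 2 + d * x.2))) ∧
    thetaSeries s w a b * thetaSeries t w c d = ∑' x : ℤ × ℤ,
      s ^ x.1 * t ^ x.2 * w ^ (a * x.1 ^ 2 + b * x.1 + (c * x.2 ^ 2 + d * x.2)) := by
  have h1 := (summable_thetaSeries hw hw1 hs ha b).norm
  have h2 := (summable_thetaSeries hw hw1 ht hc d).norm
  have e : ∀ x : ℤ × ℤ, s ^ x.1 * w ^ (a * x.1 ^ 2 + b * x.1) *
      (t ^ x.2 * w ^ (c * x.2 ^ 2 + d * x.2)) =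
      s ^ x.1 * t ^ x.2 * w ^ (a * x.1 ^ 2 + b * x.1 + (c * x.2 ^ 2 + d * x.2)) := fun x => by
    rw [zpow_add₀ hw (a * x.1 ^ 2 + b * x.1)]
    ring
  exact ⟨(summable_mul_of_summable_norm h1 h2).congr e,
    (tsum_mul_tsum_of_summable_norm h1 h2).trans (tsum_congr e)⟩

/-- The decomposition of `ℤ × ℤ` by parity of the sum of the coordinates. -/
def parityMap : Bool × ℤ × ℤ → ℤ × ℤ
  | (false, r, s) => (r + s, r - s)
  | (true, r, s) => (1 - r - s, s - r)

lemma parityMap_bijective : Function.Bijective parityMap := by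
  constructor
  · rintro ⟨_ | _, r, s⟩ ⟨_ | _, r', s'⟩ h <;>
      simp only [parityMap, Prod.mk.injEq] at h <;> simp only [Prod.mk.injEq] <;> grind
  · rintro ⟨m, n⟩
    rcases Int.emod_two_eq_zero_or_one (m + n) with h | h
    · exact ⟨(false, (m + n) / 2, (m - n) / 2), by simp only [parityMap, Prod.mk.injEq]; omega⟩
    · exact ⟨(true, (1 - m - n) / 2, (1 - m + n) / 2), by
        simp only [parityMap, Prod.mk.injEq]; omega⟩

/-- The decomposition of the Gaussian integers by residues modulo `2 + i`; the nonzero residues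
are represented by the units. -/
def gaussMap : Option (Fin 4) × ℤ × ℤ → ℤ × ℤ
  | (none, a, b) => (2 * a - b, a + 2 * b)
  | (some 0, a, b) => (1 - 2 * a - b, 2 * b - a)
  | (some 1, a, b) => (-(2 * b - a), 1 - 2 * a - b)
  | (some 2, a, b) => (-(1 - 2 * a - b), -(2 * b - a))
  | (some 3, a, b) => (2 * b - a, -(1 - 2 * a - b))

lemma gaussMap_bijective : Function.Bijective gaussMap := by
  constructor
  · rintro ⟨_ | i, r, s⟩ ⟨_ | j, r', s'⟩ h
    · simp only [gaussMap, Prod.mk.injEq] at h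
      simp only [Prod.mk.injEq, true_and]
      omega
    · fin_cases j <;> simp [gaussMap] at h <;> omega
    · fin_cases i <;> simp [gaussMap] at h <;> omega
    · fin_cases i <;> fin_cases j <;> simp [gaussMap] at h ⊢ <;> omega
  · rintro ⟨m, n⟩
    have h : (m + 3 * n) % 5 = 0 ∨ (m + 3 * n) % 5 = 1 ∨ (m + 3 * n) % 5 = 2 ∨
      (m + 3 * n) % 5 = 3 ∨ (m + 3 * n) % 5 = 4 := by omega
    rcases h with h | h | h | h | h
    · exact ⟨(none, (2 * m + n) / 5, (2 * n - m) / 5), by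
        simp only [gaussMap, Prod.mk.injEq]; omega⟩
    · exact ⟨(some 0, (2 * (1 - m) - n) / 5, (1 - m + 2 * n) / 5), by
        simp only [gaussMap, Prod.mk.injEq]; omega⟩
    · exact ⟨(some 3, (2 * (1 + n) - m) / 5, (1 + n + 2 * m) / 5), by
        simp only [gaussMap, Prod.mk.injEq]; omega⟩
    · exact ⟨(some 1, (2 * (1 - n) + m) / 5, (1 - n - 2 * m) / 5), by
        simp only [gaussMap, Prod.mk.injEq]; omega⟩
    · exact ⟨(some 2, (2 * (1 + m) + n) / 5, (1 + m - 2 * n) / 5), by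
        simp only [gaussMap, Prod.mk.injEq]; omega⟩

lemma neg_one_zpow_neg (n : ℤ) : (-1 : ℂ) ^ (-n) = (-1) ^ n := by
  rw [zpow_neg, ← inv_zpow, inv_neg_one]

lemma neg_one_zpow_add (m n : ℤ) : (-1 : ℂ) ^ (m + n) = (-1) ^ m * (-1) ^ n :=
  zpow_add₀ (by norm_num) m n

lemma neg_one_zpow_sub (m n : ℤ) : (-1 : ℂ) ^ (m - n) = (-1) ^ m * (-1) ^ n := by
  rw [sub_eq_add_neg, neg_one_zpow_add, neg_one_zpow_neg]

lemma neg_one_zpow_two_mul (n : ℤ) : (-1 : ℂ) ^ (2 * n) = 1 := by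
  rw [zpow_mul]; norm_num

/-- A two-term product formula for theta series obtained from the parity decomposition. -/
lemma thetaSeries_mul_parity {w σ : ℂ} (hw : w ≠ 0) (hw1 : ‖w‖ < 1) (hσ : σ = 1 ∨ σ = -1) :
    thetaSeries σ w (5 : ℕ) (-3) * thetaSeries (-σ) w (5 : ℕ) (-1) =
      thetaSeries (-1) w (10 : ℕ) (-4) * thetaSeries (-1) w (10 : ℕ) (-2) +
      σ * w ^ 2 *
        (thetaSeries (-1) w (10 : ℕ) (-6) * thetaSeries (-1) w (10 : ℕ) (-8)) := by
  have hσ0 : σ ≠ 0 := by rcases hσ with rfl | rfl <;> norm_num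
  have h1 : (-1 : ℂ) ≠ 0 := by norm_num
  obtain ⟨hs, hm⟩ := thetaSeries_mul hw hw1 hσ0 (neg_ne_zero.2 hσ0) (a := 5) (c := 5)
    (by norm_num) (by norm_num) (-3) (-1)
  rw [hm, tsum_eq_sum_tsum_of_bijective hs parityMap parityMap_bijective, Fintype.sum_bool,
    (thetaSeries_mul hw hw1 h1 h1 (by norm_num) (by norm_num) (-4) (-2)).2,
    (thetaSeries_mul hw hw1 h1 h1 (by norm_num) (by norm_num) (-6) (-8)).2,
    ← tsum_mul_left, add_comm]
  congr 1
  · refine tsum_congr fun ⟨r, s⟩ => ?_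
    have e : ((5 : ℕ) : ℤ) * (r + s) ^ 2 + -3 * (r + s) + ((5 : ℕ) * (r - s) ^ 2 + -1 * (r - s)) =
        (10 : ℕ) * r ^ 2 + -4 * r + ((10 : ℕ) * s ^ 2 + -2 * s) := by push_cast; ring
    simp only [parityMap]
    rw [e]
    congr 1
    rcases hσ with rfl | rfl
    · simp [neg_one_zpow_sub]
    · simp [neg_one_zpow_add]
  · refine tsum_congr fun ⟨r, s⟩ => ?_
    have e : ((5 : ℕ) : ℤ) * (1 - r - s) ^ 2 + -3 * (1 - r - s) +
        ((5 : ℕ) * (s - r) ^ 2 + -1 * (s - r)) =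
        (2 : ℕ) + ((10 : ℕ) * r ^ 2 + -6 * r + ((10 : ℕ) * s ^ 2 + -8 * s)) := by push_cast; ring
    simp only [parityMap]
    rw [e, zpow_add₀ hw ((2 : ℕ) : ℤ), zpow_natCast]
    rcases hσ with rfl | rfl
    · simp [neg_one_zpow_sub]; ring
    · simp [neg_one_zpow_sub]; ring

/-- The identity `φ(-q)² = φ(-q⁵)² - 4 q f(-q, -q⁹) f(-q³, -q⁷)`. -/
lemma thetaSeries_sq {w : ℂ} (hw : w ≠ 0) (hw1 : ‖w‖ < 1) :
    thetaSeries (-1) w (2 : ℕ) 0 ^ 2 = thetaSeries (-1) w (10 : ℕ) 0 ^ 2 -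
      4 * w ^ 2 * (thetaSeries (-1) w (10 : ℕ) (-8) * thetaSeries (-1) w (10 : ℕ) (-4)) := by
  have h1 : (-1 : ℂ) ≠ 0 := by norm_num
  obtain ⟨hs, hm⟩ := thetaSeries_mul hw hw1 h1 h1 (a := 2) (c := 2)
    (by norm_num) (by norm_num) 0 0
  have h0 : thetaSeries (-1) w (10 : ℕ) 0 * thetaSeries (-1) w (10 : ℕ) 0 =
      ∑' y : ℤ × ℤ, (-1) ^ (gaussMap (none, y)).1 * (-1) ^ (gaussMap (none, y)).2 *
        w ^ (((2 : ℕ) : ℤ) * (gaussMap (none, y)).1 ^ 2 + 0 * (gaussMap (none, y)).1 +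
          ((2 : ℕ) * (gaussMap (none, y)).2 ^ 2 + 0 * (gaussMap (none, y)).2)) := by
    rw [(thetaSeries_mul hw hw1 h1 h1 (by norm_num) (by norm_num) 0 0).2]
    refine tsum_congr fun ⟨a, b⟩ => ?_
    simp only [gaussMap]
    have e : ((2 : ℕ) : ℤ) * (2 * a - b) ^ 2 + 0 * (2 * a - b) +
        ((2 : ℕ) * (a + 2 * b) ^ 2 + 0 * (a + 2 * b)) =
        (10 : ℕ) * a ^ 2 + 0 * a + ((10 : ℕ) * b ^ 2 + 0 * b) := by push_cast; ring
    rw [e, neg_one_zpow_sub, neg_one_zpow_add, neg_one_zpow_two_mul, neg_one_zpow_two_mul]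
    ring
  have hi : ∀ i : Fin 4, ∑' y : ℤ × ℤ, (-1) ^ (gaussMap (some i, y)).1 *
        (-1) ^ (gaussMap (some i, y)).2 *
        w ^ (((2 : ℕ) : ℤ) * (gaussMap (some i, y)).1 ^ 2 + 0 * (gaussMap (some i, y)).1 +
          ((2 : ℕ) * (gaussMap (some i, y)).2 ^ 2 + 0 * (gaussMap (some i, y)).2)) =
      -(w ^ 2 * (thetaSeries (-1) w (10 : ℕ) (-8) * thetaSeries (-1) w (10 : ℕ) (-4))) := by
    intro i
    rw [(thetaSeries_mul hw hw1 h1 h1 (by norm_num) (by norm_num) (-8) (-4)).2,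
      ← tsum_mul_left, ← tsum_neg]
    refine tsum_congr fun ⟨a, b⟩ => ?_
    have e : ((2 : ℕ) : ℤ) * (1 - 2 * a - b) ^ 2 + 0 * (1 - 2 * a - b) +
        ((2 : ℕ) * (2 * b - a) ^ 2 + 0 * (2 * b - a)) =
        (2 : ℕ) + ((10 : ℕ) * a ^ 2 + -8 * a + ((10 : ℕ) * b ^ 2 + -4 * b)) := by
      push_cast; ring
    have key : (-1 : ℂ) ^ (1 - 2 * a - b) * (-1) ^ (2 * b - a) *
        w ^ (((2 : ℕ) : ℤ) * (1 - 2 * a - b) ^ 2 + 0 * (1 - 2 * a - b) +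
          ((2 : ℕ) * (2 * b - a) ^ 2 + 0 * (2 * b - a))) =
        -(w ^ 2 * ((-1) ^ a * (-1) ^ b *
          w ^ (((10 : ℕ) : ℤ) * a ^ 2 + -8 * a + ((10 : ℕ) * b ^ 2 + -4 * b)))) := by
      rw [e, zpow_add₀ hw ((2 : ℕ) : ℤ), zpow_natCast, neg_one_zpow_sub, neg_one_zpow_sub,
        neg_one_zpow_sub, neg_one_zpow_two_mul, neg_one_zpow_two_mul, zpow_one]
      ring
    rw [← key]
    fin_cases i <;>
      simp only [gaussMap, neg_one_zpow_neg, neg_sq, zero_mul, add_zero] <;> ring_nf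
  rw [sq, hm, tsum_eq_sum_tsum_of_bijective hs gaussMap gaussMap_bijective,
    Fintype.sum_option, ← h0, sum_congr rfl fun i _ => hi i]
  simp only [sum_const, card_univ, Fintype.card_fin, nsmul_eq_mul]
  push_cast
  ring

lemma rogersRamanujan_identity_of_products {q t₁ t₂ t₃ t₄ F : ℂ} (hF : F ≠ 0)
    (h₁ : t₁ ≠ 0) (h₂ : t₂ ≠ 0) (h₃ : t₃ ≠ 0) (h₄ : t₄ ≠ 0)
    (hadd : F ^ 2 * t₂ ^ 2 * t₃ = t₁ * t₄ * (t₃ * t₄ + q * t₁ * t₂))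
    (hsub : F ^ 2 * t₁ * t₄ ^ 2 = t₂ * t₃ * (t₃ * t₄ - q * t₁ * t₂))
    (hsq : t₁ ^ 4 * t₂ ^ 2 * t₃ ^ 4 * t₄ ^ 2 * F ^ 4 = F ^ 4 - 4 * q * t₁ * t₃) :
    (1 / (t₂ * t₃)) ^ 4 * (1 / t₂) ^ 2 - (1 / (t₁ * t₄)) ^ 4 * (1 / t₄) ^ 2 +
      (1 / (t₁ * t₄)) ^ 2 * (1 / (t₂ * t₃)) ^ 2 * (1 / t₂) * (1 / t₄) =
    (1 / t₂) ^ 3 * (1 / t₄) ^ 3 / ((1 / (t₁ * t₄)) ^ 2 * (1 / (t₂ * t₃)) ^ 2) := by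
  have key : t₁ ^ 4 * t₄ ^ 6 - t₂ ^ 6 * t₃ ^ 4 + t₁ ^ 2 * t₂ ^ 3 * t₃ ^ 2 * t₄ ^ 3 =
      t₁ ^ 6 * t₂ ^ 5 * t₃ ^ 6 * t₄ ^ 5 := by
    apply mul_left_cancel₀ (pow_ne_zero 4 hF)
    linear_combination (t₁ ^ 2 * t₄ ^ 2) *
        (F ^ 2 * t₁ * t₄ ^ 2 + t₂ * t₃ * (t₃ * t₄ - q * t₁ * t₂)) * hsub -
      (t₂ ^ 2 * t₃ ^ 2) *
        (F ^ 2 * t₂ ^ 2 * t₃ + t₁ * t₄ * (t₃ * t₄ + q * t₁ * t₂)) * hadd -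
      t₁ ^ 2 * t₂ ^ 3 * t₃ ^ 2 * t₄ ^ 3 * hsq
  field_simp
  linear_combination key

lemma thetaSeries_eq_prod_sq {w s : ℂ} (hw : w ≠ 0) (hw1 : ‖w‖ < 1) (hs : s = 1 ∨ s = -1)
    {c d : ℕ} (hcd : c + d ≠ 0) :
    thetaSeries s w (c + d : ℕ) (c - d) = qp ((w ^ 2) ^ (c + d)) ((w ^ 2) ^ (c + d)) *
      qp (-(s * (w ^ 2) ^ c)) ((w ^ 2) ^ (c + d)) *
      qp (-(s * (w ^ 2) ^ d)) ((w ^ 2) ^ (c + d)) := by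
  have hs0 : s ≠ 0 := by rcases hs with rfl | rfl <;> norm_num
  have hinv : s⁻¹ = s := by rcases hs with rfl | rfl <;> norm_num
  have e1 : w ^ (((c + d : ℕ) : ℤ) + (c - d)) = (w ^ 2) ^ c := by
    rw [← pow_mul, ← zpow_natCast]; congr 1; push_cast; ring
  have e2 : w ^ (((c + d : ℕ) : ℤ) - (c - d)) = (w ^ 2) ^ d := by
    rw [← pow_mul, ← zpow_natCast]; congr 1; push_cast; ring
  rw [thetaSeries_eq_prod hw hw1 hs0 hcd, e1, e2, hinv, pow_mul]

lemma rogersRamanujan_products {q : ℂ} (hq : q ≠ 0) (hq1 : ‖q‖ < 1) :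
    ∃ t₁ t₂ t₃ t₄ F : ℂ, (t₁ ≠ 0 ∧ t₂ ≠ 0 ∧ t₃ ≠ 0 ∧ t₄ ≠ 0 ∧ F ≠ 0) ∧
      (G q = 1 / (t₁ * t₄) ∧ H q = 1 / (t₂ * t₃) ∧ G (q ^ 2) = 1 / t₂ ∧ H (q ^ 2) = 1 / t₄) ∧
      F ^ 2 * t₂ ^ 2 * t₃ = t₁ * t₄ * (t₃ * t₄ + q * t₁ * t₂) ∧
      F ^ 2 * t₁ * t₄ ^ 2 = t₂ * t₃ * (t₃ * t₄ - q * t₁ * t₂) ∧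
      t₁ ^ 4 * t₂ ^ 2 * t₃ ^ 4 * t₄ ^ 2 * F ^ 4 = F ^ 4 - 4 * q * t₁ * t₃ := by
  obtain ⟨w, hw⟩ : ∃ w : ℂ, w ^ 2 = q := IsSquare.exists_sq q (by simp) |>.imp fun _ h => h.symm
  have hw0 : w ≠ 0 := by rintro rfl; exact hq (by rw [← hw]; norm_num)
  have hw1 : ‖w‖ < 1 := by
    rw [← hw, norm_pow] at hq1
    exact (pow_lt_one_iff_of_nonneg (norm_nonneg w) two_ne_zero).1 hq1
  have hpow : ∀ {n : ℕ}, n ≠ 0 → ‖q ^ n‖ < 1 := fun hn => by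
    rw [norm_pow]; exact pow_lt_one₀ (norm_nonneg q) hq1 hn
  have hQ : ∀ {n : ℕ}, n ≠ 0 → qp (q ^ n) (q ^ 10) ≠ 0 := fun hn =>
    qp_ne_zero (hpow (by norm_num)) (hpow hn)
  have h5 : ∀ k : ℕ, qp (q ^ k) (q ^ 5) = qp (q ^ k) (q ^ 10) * qp (q ^ (k + 5)) (q ^ 10) := by
    intro k
    rw [qp_eq_prod_residues _ (hpow (by norm_num : 5 ≠ 0)) two_ne_zero]
    simp [prod_range_succ, ← pow_mul, ← pow_add]
  have hneg : ∀ k : ℕ, qp (q ^ k) (q ^ 5) * qp (-q ^ k) (q ^ 5) = qp (q ^ (2 * k)) (q ^ 10) := by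
    intro k
    rw [qp_mul_qp_neg _ (hpow (by norm_num)), ← pow_mul, ← pow_mul, mul_comm k]
  have h2 : ∀ k : ℕ, qp (q ^ k) (q ^ 2) = qp (q ^ k) (q ^ 10) * qp (q ^ (k + 2)) (q ^ 10) *
      qp (q ^ (k + 4)) (q ^ 10) * qp (q ^ (k + 6)) (q ^ 10) * qp (q ^ (k + 8)) (q ^ 10) := by
    intro k
    rw [qp_eq_prod_residues _ (hpow (by norm_num : 2 ≠ 0)) (by norm_num : 5 ≠ 0)]
    simp [prod_range_succ, ← pow_mul, ← pow_add]
  have hth : ∀ c d : ℕ, c + d ≠ 0 → thetaSeries (-1) w (c + d : ℕ) (c - d) =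
      qp (q ^ (c + d)) (q ^ (c + d)) * qp (q ^ c) (q ^ (c + d)) * qp (q ^ d) (q ^ (c + d)) := by
    intro c d h
    simpa [hw] using thetaSeries_eq_prod_sq hw0 hw1 (Or.inr rfl) h
  have hth' : ∀ c d : ℕ, c + d ≠ 0 → thetaSeries 1 w (c + d : ℕ) (c - d) =
      qp (q ^ (c + d)) (q ^ (c + d)) * qp (-q ^ c) (q ^ (c + d)) * qp (-q ^ d) (q ^ (c + d)) := by
    intro c d h
    simpa [hw] using thetaSeries_eq_prod_sq hw0 hw1 (Or.inl rfl) h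
  have hadd := thetaSeries_mul_parity hw0 hw1 (Or.inl rfl)
  have hsub := thetaSeries_mul_parity hw0 hw1 (Or.inr rfl)
  have hsq := thetaSeries_sq hw0 hw1
  have a1 := hth 1 4 (by norm_num)
  have a2 := hth 2 3 (by norm_num)
  have a3 := hth' 1 4 (by norm_num)
  have a4 := hth' 2 3 (by norm_num)
  have b1 := hth 1 9 (by norm_num)
  have b2 := hth 2 8 (by norm_num)
  have b3 := hth 3 7 (by norm_num)
  have b4 := hth 4 6 (by norm_num)
  have b5 := hth 5 5 (by norm_num)
  have c1 := hth 1 1 (by norm_num)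
  norm_num at hadd hsub hsq a1 a2 a3 a4 b1 b2 b3 b4 b5 c1
  have n1 := hneg 1
  have n2 := hneg 2
  have n3 := hneg 3
  have n4 := hneg 4
  have f1 := h5 1
  have f2 := h5 2
  have f3 := h5 3
  have f4 := h5 4
  have f5 := h5 5
  have g1 := h2 1
  have g2 := h2 2
  norm_num at n1 n2 n3 n4 f1 f2 f3 f4 f5 g1 g2
  have hP := hQ (n := 10) (by norm_num)
  have i1 := hQ (n := 1) (by norm_num)
  rw [pow_one] at i1
  have i2 := hQ (n := 2) (by norm_num)
  have i3 := hQ (n := 3) (by norm_num)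
  have i4 := hQ (n := 4) (by norm_num)
  have i5 := hQ (n := 5) (by norm_num)
  have i6 := hQ (n := 6) (by norm_num)
  have i7 := hQ (n := 7) (by norm_num)
  have i8 := hQ (n := 8) (by norm_num)
  have i9 := hQ (n := 9) (by norm_num)
  refine ⟨qp q (q ^ 10) * qp (q ^ 9) (q ^ 10), qp (q ^ 2) (q ^ 10) * qp (q ^ 8) (q ^ 10),
    qp (q ^ 3) (q ^ 10) * qp (q ^ 7) (q ^ 10), qp (q ^ 4) (q ^ 10) * qp (q ^ 6) (q ^ 10),
    qp (q ^ 5) (q ^ 10), ?_, ?_, ?_, ?_, ?_⟩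
  · simp_all
  · refine ⟨?_, ?_, ?_, ?_⟩
    · rw [G, f1, f4]; ring
    · rw [H, f2, f3]; ring
    · simp only [G, ← pow_mul]
    · simp only [H, ← pow_mul]
  · rw [a3, a2, b1, b2, b3, b4, hw, f5, f2, f3] at hadd
    rw [f1] at n1
    rw [f4] at n4
    apply mul_left_cancel₀ (pow_ne_zero 2 hP)
    linear_combination
      (qp q (q ^ 10) * qp (q ^ 9) (q ^ 10) * qp (q ^ 4) (q ^ 10) * qp (q ^ 6) (q ^ 10)) * hadd -
      (qp (q ^ 5) (q ^ 10) ^ 2 * qp (q ^ 10) (q ^ 10) ^ 2 * qp (q ^ 2) (q ^ 10) *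
        qp (q ^ 7) (q ^ 10) * qp (q ^ 3) (q ^ 10) * qp (q ^ 8) (q ^ 10)) *
        (qp (q ^ 8) (q ^ 10) * n1 +
          qp q (q ^ 10) * qp (q ^ 6) (q ^ 10) * qp (-q) (q ^ 5) * n4)
  · rw [a1, a4, b1, b2, b3, b4, hw, f5, f1, f4] at hsub
    rw [f2] at n2
    rw [f3] at n3
    apply mul_left_cancel₀ (pow_ne_zero 2 hP)
    linear_combination
      (qp (q ^ 2) (q ^ 10) * qp (q ^ 8) (q ^ 10) * qp (q ^ 3) (q ^ 10) * qp (q ^ 7) (q ^ 10)) *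
        hsub -
      (qp (q ^ 5) (q ^ 10) ^ 2 * qp (q ^ 10) (q ^ 10) ^ 2 * qp q (q ^ 10) *
        qp (q ^ 6) (q ^ 10) * qp (q ^ 4) (q ^ 10) * qp (q ^ 9) (q ^ 10)) *
        (qp (q ^ 6) (q ^ 10) * n2 +
          qp (q ^ 2) (q ^ 10) * qp (q ^ 7) (q ^ 10) * qp (-q ^ 2) (q ^ 5) * n3)
  · rw [c1, b1, b3, b5, hw, g1, g2] at hsq
    apply mul_left_cancel₀ (pow_ne_zero 2 hP)
    linear_combination hsq

theorem stmt_7 : ∀ q : ℂ, ‖q‖ < 1 →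
    H q ^ 4 * G (q ^ 2) ^ 2 - G q ^ 4 * H (q ^ 2) ^ 2 + G q ^ 2 * H q ^ 2 * G (q ^ 2) * H (q ^ 2)
      = G (q ^ 2) ^ 3 * H (q ^ 2) ^ 3 / (G q ^ 2 * H q ^ 2) := by
  intro q hq1
  rcases eq_or_ne q 0 with rfl | hq
  · simp [G, H, qp]
  obtain ⟨t₁, t₂, t₃, t₄, F, ⟨h₁, h₂, h₃, h₄, hF⟩, ⟨hG, hH, hG2, hH2⟩, hadd, hsub, hsq⟩ :=
    rogersRamanujan_products hq hq1
  rw [hG, hH, hG2, hH2]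
  exact rogersRamanujan_identity_of_products hF h₁ h₂ h₃ h₄ hadd hsub hsq
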